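/- arXiv:2509.01781 — 2 statements merged into one kernel-verified Lean document; each statement's English description precedes it below -/
import Mathlib

section
/- Let u, v, r be rational numbers with u ≠ 0, and let n ≥ 3 be an odd integer. Set t_n = u·F_{n−2} + v·F_{n−1} and t_{n+1} = u·F_{n−1} + v·F_n. Then both of the following identities hold in the rationals: (i) 1 + (1/2)(r·F_{n−1} + ((v·r−1)/u)·F_n − 1)·t_n + (1/2)((u−r)·F_{n−2} + (((u−r)·v+1)/u)·F_{n−1} − 1)·t_{n+1} = (t_n−1)(t_{n+1}−1)/2; (ii) (1/2)(r·F_{n−1} + ((v·r+1)/u)·F_n − 1)·t_n + (1/2)((u−r)·F_{n−2} + (((u−r)·v−1)/u)·F_{n−1} − 1)·t_{n+1} = (t_n−1)(t_{n+1}−1)/2. -/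
/-- The Fibonacci numbers, regarded as rationals. -/
def F (m : ℕ) : ℚ := Nat.fib m

/-- Cassini's identity at odd indices. -/
theorem fib_cassini_odd (k : ℕ) :
    F (2 * k + 3) * F (2 * k + 1) - F (2 * k + 2) ^ 2 = 1 := by
  induction k with
  | zero => norm_num [F, Nat.fib_add_two]
  | succ k ih =>
    have fib_rec (m : ℕ) : F (m + 2) = F m + F (m + 1) := by
      simp [F, Nat.fib_add_two]
    have h₃ := fib_rec (2 * k + 1)
    have h₄ := fib_rec (2 * k + 2)
    have h₅ := fib_rec (2 * k + 3)
    simp only [Nat.mul_add, Nat.add_assoc, Nat.reduceMul, Nat.reduceAdd] at *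
    rw [h₅, h₄, h₃]
    rw [h₃] at ih
    linear_combination ih

theorem stmt_12 (u v r : ℚ) (hu : u ≠ 0) (n : ℕ) (hn : 3 ≤ n) (hodd : Odd n) :
    (1 + (1/2) * (r * F (n-1) + ((v * r - 1) / u) * F n - 1)
            * (u * F (n-2) + v * F (n-1))
       + (1/2) * ((u - r) * F (n-2) + (((u - r) * v + 1) / u) * F (n-1) - 1)
            * (u * F (n-1) + v * F n)
       = ((u * F (n-2) + v * F (n-1)) - 1) * ((u * F (n-1) + v * F n) - 1) / 2) ∧
    ((1/2) * (r * F (n-1) + ((v * r + 1) / u) * F n - 1)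
            * (u * F (n-2) + v * F (n-1))
       + (1/2) * ((u - r) * F (n-2) + (((u - r) * v - 1) / u) * F (n-1) - 1)
            * (u * F (n-1) + v * F n)
       = ((u * F (n-2) + v * F (n-1)) - 1) * ((u * F (n-1) + v * F n) - 1) / 2) := by
  obtain ⟨k, rfl⟩ : ∃ k, n = 2 * k + 3 := by
    obtain ⟨m, rfl⟩ := hodd
    exact ⟨m - 1, by omega⟩
  have cassini := fib_cassini_odd k
  rw [show 2 * k + 3 - 1 = 2 * k + 2 by omega, show 2 * k + 3 - 2 = 2 * k + 1 by omega]
  generalize F (2 * k + 1) = a at *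
  generalize F (2 * k + 2) = b at *
  generalize F (2 * k + 3) = c at *
  constructor
  · field_simp
    linear_combination -u * cassini
  · field_simp
    linear_combination u * cassini
end

section
/- Let u, v, r be rational numbers with u ≠ 0, and let n ≥ 2 be an even integer. Set t_n = u·F_{n−2} + v·F_{n−1} and t_{n+1} = u·F_{n−1} + v·F_n. Then both of the following identities hold in the rationals: (i) 1 + (1/2)((u−r)·F_{n−1} + (((u−r)·v+1)/u)·F_n − 1)·t_n + (1/2)(r·F_{n−2} + ((v·r−1)/u)·F_{n−1} − 1)·t_{n+1} = (t_n−1)(t_{n+1}−1)/2; (ii) (1/2)((u−r)·F_{n−1} + (((u−r)·v−1)/u)·F_n − 1)·t_n + (1/2)(r·F_{n−2} + ((v·r+1)/u)·F_{n−1} − 1)·t_{n+1} = (t_n−1)(t_{n+1}−1)/2. -/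
theorem F_add_two (m : ℕ) : F (m + 2) = F m + F (m + 1) := by
  simp [F, Nat.fib_add_two]

/-- Cassini's identity at an even index, in terms of two consecutive Fibonacci numbers. -/
theorem F_cassini_two_mul (k : ℕ) :
    F (2 * k) * (F (2 * k) + F (2 * k + 1)) - F (2 * k + 1) ^ 2 = -1 := by
  induction k with
  | zero => norm_num [F]
  | succ k ih =>
    rw [show 2 * (k + 1) = 2 * k + 2 by ring, F_add_two (2 * k + 1), F_add_two (2 * k)]
    linear_combination ih

theorem stmt_13 (u v r : ℚ) (hu : u ≠ 0) (n : ℕ) (hn : 2 ≤ n) (heven : Even n) :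
    (1 + (1/2) * ((u - r) * F (n-1) + (((u - r) * v + 1) / u) * F n - 1)
            * (u * F (n-2) + v * F (n-1))
       + (1/2) * (r * F (n-2) + ((v * r - 1) / u) * F (n-1) - 1)
            * (u * F (n-1) + v * F n)
       = ((u * F (n-2) + v * F (n-1)) - 1) * ((u * F (n-1) + v * F n) - 1) / 2) ∧
    ((1/2) * ((u - r) * F (n-1) + (((u - r) * v - 1) / u) * F n - 1)
            * (u * F (n-2) + v * F (n-1))
       + (1/2) * (r * F (n-2) + ((v * r + 1) / u) * F (n-1) - 1)
            * (u * F (n-1) + v * F n)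
       = ((u * F (n-2) + v * F (n-1)) - 1) * ((u * F (n-1) + v * F n) - 1) / 2) := by
  obtain ⟨k, rfl⟩ : ∃ k, n = 2 * k + 2 := by
    obtain ⟨m, rfl⟩ := heven
    exact ⟨m - 1, by omega⟩
  have hcas := F_cassini_two_mul k
  rw [show 2 * k + 2 - 1 = 2 * k + 1 by omega, show 2 * k + 2 - 2 = 2 * k by omega, F_add_two]
  generalize F (2 * k) = a at *
  generalize F (2 * k + 1) = b at *
  constructor
  · field_simp
    linear_combination u * hcas
  · field_simp
    linear_combination -u * hcas
end
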